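/- arXiv:2304.13071 — 11 statements merged into one kernel-verified Lean document; each statement's English description precedes it below -/
import Mathlib

section
/- Let (D, ⊢, ⊣, α) be a Hom-Leibniz-admissible dialgebra over a field k of characteristic 0. Then the bilinear multiplication defined by xy := x⊢y − y⊣x makes (D, α) a left Hom-Leibniz algebra, i.e. α(x)(yz) = (xy)α(z) + α(y)(xz) for all x, y, z ∈ D. -/
/-- The left Hom-Leibniz identity: `α(x)(yz) = (xy)α(z) + α(y)(xz)`. -/
def IsLeftHomLeibniz {G : Type*} [AddCommGroup G] (mul : G → G → G) (α : G → G) : Prop :=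
  ∀ x y z, mul (α x) (mul y z) = mul (mul x y) (α z) + mul (α y) (mul x z)

/-- The right Hom-Leibniz identity: `(xy)α(z) = (xz)α(y) + α(x)(yz)`. -/
def IsRightHomLeibniz {G : Type*} [AddCommGroup G] (mul : G → G → G) (α : G → G) : Prop :=
  ∀ x y z, mul (mul x y) (α z) = mul (mul x z) (α y) + mul (α x) (mul y z)

/-- `(M, αM)` with left/right actions `la`, `ra` is a bimodule of the left
Hom-Leibniz algebra `(G, mul, α)`: hom compatibility and conditions (L1), (L2), (L3). -/
def IsHomBimodule {G M : Type*} [AddCommGroup G] [AddCommGroup M]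
    (mul : G → G → G) (α : G → G) (la : G → M → M) (ra : M → G → M) (αM : M → M) : Prop :=
  (∀ x m, αM (la x m) = la (α x) (αM m)) ∧
  (∀ m x, αM (ra m x) = ra (αM m) (α x)) ∧
  (∀ x y m, la (α x) (la y m) = la (mul x y) (αM m) + la (α y) (la x m)) ∧
  (∀ m x y, ra (αM m) (mul x y) = ra (ra m x) (α y) + la (α x) (ra m y)) ∧
  (∀ x m y, la (α x) (ra m y) = ra (la x m) (α y) + ra (αM m) (mul x y))

/-- `(M, G, f)` is a left Hom-Leibniz algebra in the Loday–Pirashvili category `LM`. -/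
def IsLMHomLeibniz {G M : Type*} [AddCommGroup G] [AddCommGroup M]
    (mul : G → G → G) (α : G → G) (la : G → M → M) (ra : M → G → M) (αM : M → M)
    (f : M → G) : Prop :=
  IsLeftHomLeibniz mul α ∧ IsHomBimodule mul α la ra αM ∧
  (∀ m, α (f m) = f (αM m)) ∧
  (∀ x m, f (la x m) = mul x (f m)) ∧
  (∀ m x, f (ra m x) = mul (f m) x)

/-- The semidirect product multiplication on `G × M`. -/
def sdMul {G M : Type*} [Add M] (mul : G → G → G) (la : G → M → M) (ra : M → G → M) :
    G × M → G × M → G × M :=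
  fun a b => (mul a.1 b.1, la a.1 b.2 + ra a.2 b.1)

/-- The hom map on a direct sum. -/
def sdHom {G M : Type*} (α : G → G) (αM : M → M) : G × M → G × M :=
  fun a => (α a.1, αM a.2)

/-- `(V, W, φ)` together with `tr = ▷ : W × M → V` and `tl = ◁ : M × W → V`
is a bimodule of the left Hom-Leibniz algebra `(M, G, f)` in `LM`. -/
def IsLMBimodule {G M W V : Type*}
    [AddCommGroup G] [AddCommGroup M] [AddCommGroup W] [AddCommGroup V]
    (mul : G → G → G) (α : G → G) (la : G → M → M) (ra : M → G → M) (αM : M → M) (f : M → G)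
    (laW : G → W → W) (raW : W → G → W) (αW : W → W)
    (laV : G → V → V) (raV : V → G → V) (αV : V → V)
    (tr : W → M → V) (tl : M → W → V) (φ : V → W) : Prop :=
  IsHomBimodule mul α laV raV αV ∧
  IsHomBimodule mul α laW raW αW ∧
  (∀ v, φ (αV v) = αW (φ v)) ∧
  (∀ x v, φ (laV x v) = laW x (φ v)) ∧
  (∀ v x, φ (raV v x) = raW (φ v) x) ∧
  (∀ w m, φ (tr w m) = raW w (f m)) ∧
  (∀ m w, φ (tl m w) = laW (f m) w) ∧
  (∀ x w m, laV (α x) (tr w m) = tr (laW x w) (αM m) + tr (αW w) (la x m)) ∧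
  (∀ x w m, tr (αW w) (la x m) = tr (raW w x) (αM m) + laV (α x) (tr w m)) ∧
  (∀ x w m, tl (αM m) (raW w x) = raV (tl m w) (α x) + tr (αW w) (ra m x)) ∧
  (∀ x w m, tl (αM m) (laW x w) = tl (ra m x) (αW w) + laV (α x) (tl m w)) ∧
  (∀ x w m, laV (α x) (tl m w) = tl (la x m) (αW w) + tl (αM m) (laW x w)) ∧
  (∀ x w m, tr (αW w) (ra m x) = raV (tr w m) (α x) + tl (αM m) (raW w x))

/-- `(ω, μ, ν, θ)` is a 2-cocycle of the left Hom-Leibniz algebra `(M, G, f)` in `LM`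
with coefficients in the bimodule `(V, W, φ)` (conditions (C1)–(C6)). -/
def IsTwoCocycle {G M W V : Type*}
    [AddCommGroup G] [AddCommGroup M] [AddCommGroup W] [AddCommGroup V]
    (mul : G → G → G) (α : G → G) (la : G → M → M) (ra : M → G → M) (αM : M → M) (f : M → G)
    (laW : G → W → W) (raW : W → G → W)
    (laV : G → V → V) (raV : V → G → V)
    (tr : W → M → V) (tl : M → W → V) (φ : V → W)
    (ω : G → G → W) (μ : G → M → V) (ν : M → G → V) (θ : M → W) : Prop :=
  (∀ x y z, laW (α x) (ω y z) + ω (α x) (mul y z) - ω (mul x y) (α z)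
      - raW (ω x y) (α z) - laW (α y) (ω x z) - ω (α y) (mul x z) = 0) ∧
  (∀ x y m, laV (α x) (μ y m) + μ (α x) (la y m) - tr (ω x y) (αM m)
      - μ (mul x y) (αM m) - laV (α y) (μ x m) - μ (α y) (la x m) = 0) ∧
  (∀ x y m, tl (αM m) (ω x y) + ν (αM m) (mul x y) - raV (ν m x) (α y)
      - ν (ra m x) (α y) - laV (α x) (ν m y) - μ (α x) (ra m y) = 0) ∧
  (∀ x y m, laV (α x) (ν m y) + μ (α x) (ra m y) - ν (la x m) (α y)
      - raV (μ x m) (α y) - tl (αM m) (ω x y) - ν (αM m) (mul x y) = 0) ∧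
  (∀ x m, θ (la x m) + φ (μ x m) - laW x (θ m) - ω x (f m) = 0) ∧
  (∀ m x, θ (ra m x) + φ (ν m x) - ω (f m) x - raW (θ m) x = 0)

/-- A formal deformation of the left Hom-Leibniz algebra `(M, G, f)` in `LM`:
the zeroth-order terms are the original operations and the six coefficient-wise
deformation equations hold. -/
def IsFormalDeformation {G M : Type*} [AddCommGroup G] [AddCommGroup M]
    (mul : G → G → G) (α : G → G) (la : G → M → M) (ra : M → G → M) (αM : M → M) (f : M → G)
    (ω : ℕ → G → G → G) (μ : ℕ → G → M → M) (ν : ℕ → M → G → M) (θ : ℕ → M → G) : Prop :=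
  (∀ x y, ω 0 x y = mul x y) ∧ (∀ x m, μ 0 x m = la x m) ∧
  (∀ m x, ν 0 m x = ra m x) ∧ (∀ m, θ 0 m = f m) ∧
  (∀ (n : ℕ) (x : G) (m : M),
    ∑ p ∈ Finset.HasAntidiagonal.antidiagonal n, θ p.1 (μ p.2 x m)
      = ∑ p ∈ Finset.HasAntidiagonal.antidiagonal n, ω p.1 x (θ p.2 m)) ∧
  (∀ (n : ℕ) (m : M) (x : G),
    ∑ p ∈ Finset.HasAntidiagonal.antidiagonal n, θ p.1 (ν p.2 m x)
      = ∑ p ∈ Finset.HasAntidiagonal.antidiagonal n, ω p.1 (θ p.2 m) x) ∧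
  (∀ (n : ℕ) (x y z : G),
    ∑ p ∈ Finset.HasAntidiagonal.antidiagonal n, ω p.1 (α x) (ω p.2 y z)
      = ∑ p ∈ Finset.HasAntidiagonal.antidiagonal n, ω p.1 (ω p.2 x y) (α z)
        + ∑ p ∈ Finset.HasAntidiagonal.antidiagonal n, ω p.1 (α y) (ω p.2 x z)) ∧
  (∀ (n : ℕ) (x y : G) (m : M),
    ∑ p ∈ Finset.HasAntidiagonal.antidiagonal n, μ p.1 (α x) (μ p.2 y m)
      = ∑ p ∈ Finset.HasAntidiagonal.antidiagonal n, μ p.1 (ω p.2 x y) (αM m)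
        + ∑ p ∈ Finset.HasAntidiagonal.antidiagonal n, μ p.1 (α y) (μ p.2 x m)) ∧
  (∀ (n : ℕ) (x y : G) (m : M),
    ∑ p ∈ Finset.HasAntidiagonal.antidiagonal n, ν p.1 (αM m) (ω p.2 x y)
      = ∑ p ∈ Finset.HasAntidiagonal.antidiagonal n, ν p.1 (ν p.2 m x) (α y)
        + ∑ p ∈ Finset.HasAntidiagonal.antidiagonal n, μ p.1 (α x) (ν p.2 m y)) ∧
  (∀ (n : ℕ) (x y : G) (m : M),
    ∑ p ∈ Finset.HasAntidiagonal.antidiagonal n, μ p.1 (α x) (ν p.2 m y)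
      = ∑ p ∈ Finset.HasAntidiagonal.antidiagonal n, ν p.1 (μ p.2 x m) (α y)
        + ∑ p ∈ Finset.HasAntidiagonal.antidiagonal n, ν p.1 (αM m) (ω p.2 x y))

/-- Equivalence of two formal deformations `(ω, μ, ν, θ)` and `(ω', μ', ν', θ')`
via sequences `(ψ_i)`, `(φ_i)` with `ψ₀ = id`, `φ₀ = id`. -/
def DeformationEquiv {G M : Type*} [AddCommGroup G] [AddCommGroup M]
    (ω : ℕ → G → G → G) (μ : ℕ → G → M → M) (ν : ℕ → M → G → M) (θ : ℕ → M → G)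
    (ω' : ℕ → G → G → G) (μ' : ℕ → G → M → M) (ν' : ℕ → M → G → M) (θ' : ℕ → M → G)
    (ψ : ℕ → G → G) (Φ : ℕ → M → M) : Prop :=
  (∀ x, ψ 0 x = x) ∧ (∀ m, Φ 0 m = m) ∧
  (∀ (n : ℕ) (x y : G),
    ∑ p ∈ Finset.HasAntidiagonal.antidiagonal n, ψ p.1 (ω' p.2 x y)
      = ∑ p ∈ Finset.HasAntidiagonal.antidiagonal n, ∑ q ∈ Finset.HasAntidiagonal.antidiagonal p.2,
          ω p.1 (ψ q.1 x) (ψ q.2 y)) ∧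
  (∀ (n : ℕ) (x : G) (m : M),
    ∑ p ∈ Finset.HasAntidiagonal.antidiagonal n, Φ p.1 (μ' p.2 x m)
      = ∑ p ∈ Finset.HasAntidiagonal.antidiagonal n, ∑ q ∈ Finset.HasAntidiagonal.antidiagonal p.2,
          μ p.1 (ψ q.1 x) (Φ q.2 m)) ∧
  (∀ (n : ℕ) (m : M) (x : G),
    ∑ p ∈ Finset.HasAntidiagonal.antidiagonal n, Φ p.1 (ν' p.2 m x)
      = ∑ p ∈ Finset.HasAntidiagonal.antidiagonal n, ∑ q ∈ Finset.HasAntidiagonal.antidiagonal p.2,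
          ν p.1 (Φ q.1 m) (ψ q.2 x)) ∧
  (∀ (n : ℕ) (m : M),
    ∑ p ∈ Finset.HasAntidiagonal.antidiagonal n, ψ p.1 (θ' p.2 m)
      = ∑ p ∈ Finset.HasAntidiagonal.antidiagonal n, θ p.1 (Φ p.2 m))

/-- For a Hom-Leibniz-admissible dialgebra `(D, ⊢, ⊣, α)`,
the product `x y := x ⊢ y − y ⊣ x` makes `(D, α)` a left Hom-Leibniz algebra. -/
theorem homLeibnizAdmissible_to_left_hom_leibniz
    {k D : Type*} [Field k] [CharZero k] [AddCommGroup D] [Module k D]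
    (lp rp : D →ₗ[k] D →ₗ[k] D) (α : D →ₗ[k] D)
    (hl : IsLeftHomLeibniz (fun x y => lp x y) ⇑α)
    (hr : IsRightHomLeibniz (fun x y => rp x y) ⇑α)
    (hD1 : ∀ x y z : D, lp (α x) (rp y z) = rp (lp x y) (α z) + rp (α y) (lp x z))
    (hD2 : ∀ x y z : D, rp (lp x y) (α z) = lp (α x) (rp y z) + lp (rp x z) (α y)) :
    IsLeftHomLeibniz (fun x y => lp x y - rp y x) ⇑α := by
  intro x y z
  have h1 := hl x y z
  have h2 := hr z y x
  have h3 := hD1 x z y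
  have h4 := hD2 y z x
  beta_reduce at h1 h2
  simp only [map_sub, LinearMap.sub_apply]
  rw [h1, h2, h3, h4]
  abel
end

section
/- Let (D, ⊢, ⊣, α) be a Hom-Leibniz-admissible dialgebra over a field k of characteristic 0. Then the bilinear multiplication defined by x·y := x⊣y − y⊢x makes (D, α) a right Hom-Leibniz algebra, i.e. (x·y)·α(z) = (x·z)·α(y) + α(x)·(y·z) for all x, y, z ∈ D. -/
/-- For a Hom-Leibniz-admissible dialgebra `(D, ⊢, ⊣, α)`,
the product `x · y := x ⊣ y − y ⊢ x` makes `(D, α)` a right Hom-Leibniz algebra. -/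
theorem homLeibnizAdmissible_to_right_hom_leibniz
    {k D : Type*} [Field k] [CharZero k] [AddCommGroup D] [Module k D]
    (lp rp : D →ₗ[k] D →ₗ[k] D) (α : D →ₗ[k] D)
    (hl : IsLeftHomLeibniz (fun x y => lp x y) ⇑α)
    (hr : IsRightHomLeibniz (fun x y => rp x y) ⇑α)
    (hD1 : ∀ x y z : D, lp (α x) (rp y z) = rp (lp x y) (α z) + rp (α y) (lp x z))
    (hD2 : ∀ x y z : D, rp (lp x y) (α z) = lp (α x) (rp y z) + lp (rp x z) (α y)) :
    IsRightHomLeibniz (fun x y => rp x y - lp y x) ⇑α := by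
  intro x y z
  have h1 := hr x y z
  have h2 := hl z y x
  have h3 := hD1 z x y
  have h4 := hD2 y x z
  simp only [map_sub, LinearMap.sub_apply] at h1 h2 ⊢
  rw [h1, h2, h3, h4]
  abel
end

section
/- Let (M, g, f) be a left Hom-Leibniz algebra in the Loday–Pirashvili category LM. Define bilinear products on M by m⊣n := m·f(n) and m⊢n := f(m)·n. Then (M, ⊢, ⊣, α_M) is a left Hom-Leibniz dialgebra: (M, ⊢, α_M) is a left Hom-Leibniz algebra, and for all m, n, p ∈ M: (DL1) α_M(m)⊢(n⊣p) = (m⊢n)⊣α_M(p) + α_M(n)⊣(m⊢p); (DL2) α_M(m)⊢(n⊢p) = (m⊣n)⊢α_M(p) + α_M(n)⊢(m⊢p); (DL3) α_M(m)⊣(n⊢p) = (m⊣n)⊣α_M(p) + α_M(n)⊢(m⊣p). -/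
/-- A left Hom-Leibniz algebra `(M, g, f)` in `LM` induces a left
Hom-Leibniz dialgebra on `(M, αM)` via `m ⊣ n := m · f(n)` and `m ⊢ n := f(m) · n`:
`(M, ⊢, αM)` is a left Hom-Leibniz algebra and (DL1), (DL2), (DL3) hold. -/
theorem lm_hom_leibniz_gives_left_hom_leibniz_dialgebra
    {k g M : Type*} [Field k] [CharZero k]
    [AddCommGroup g] [Module k g] [AddCommGroup M] [Module k M]
    (mul : g →ₗ[k] g →ₗ[k] g) (α : g →ₗ[k] g)
    (la : g →ₗ[k] M →ₗ[k] M) (ra : M →ₗ[k] g →ₗ[k] M) (αM : M →ₗ[k] M)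
    (f : M →ₗ[k] g)
    (hlm : IsLMHomLeibniz (fun x y => mul x y) ⇑α
      (fun x m => la x m) (fun m x => ra m x) ⇑αM ⇑f) :
    -- `(M, ⊢, αM)` is a left Hom-Leibniz algebra
    IsLeftHomLeibniz (fun m n => la (f m) n) ⇑αM ∧
    -- (DL1) `αM(m) ⊢ (n ⊣ p) = (m ⊢ n) ⊣ αM(p) + αM(n) ⊣ (m ⊢ p)`
    (∀ m n p : M, la (f (αM m)) (ra n (f p))
        = ra (la (f m) n) (f (αM p)) + ra (αM n) (f (la (f m) p))) ∧
    -- (DL2) `αM(m) ⊢ (n ⊢ p) = (m ⊣ n) ⊢ αM(p) + αM(n) ⊢ (m ⊢ p)`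
    (∀ m n p : M, la (f (αM m)) (la (f n) p)
        = la (f (ra m (f n))) (αM p) + la (f (αM n)) (la (f m) p)) ∧
    -- (DL3) `αM(m) ⊣ (n ⊢ p) = (m ⊣ n) ⊣ αM(p) + αM(n) ⊢ (m ⊣ p)`
    (∀ m n p : M, ra (αM m) (f (la (f n) p))
        = ra (ra m (f n)) (f (αM p)) + la (f (αM n)) (ra m (f p))) := by
  obtain ⟨-, ⟨-, -, h1, h2, h3⟩, ha, hl, hr⟩ := hlm
  dsimp only at h1 h2 h3 ha hl hr
  refine ⟨fun m n p => ?_, fun m n p => ?_, fun m n p => ?_, fun m n p => ?_⟩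
  · dsimp only
    rw [← ha, ← ha, hl, h1]
  · rw [← ha, ← ha, hl, h3]
  · rw [← ha, ← ha, hr, h1]
  · rw [← ha, ← ha, hl, h2]
end

section
/- Let (M, g, f) be a left Hom-Leibniz algebra in LM over a field k of characteristic 0 and let (N₀, N₁) be a Nijenhuis operator with α∘N₀ = N₀∘α and α_M∘N₁ = N₁∘α_M. Define θ(m) := f(N₁(m)) − N₀(f(m)), ω(x,y) := N₀(x)y + xN₀(y) − N₀(xy), μ(x,m) := N₀(x)·m + x·N₁(m) − N₁(x·m), ν(m,x) := m·N₀(x) + N₁(m)·x − N₁(m·x). Then for every λ ∈ k, the deformed operations f_λ := f + λθ, x·_λ y := xy + λω(x,y), x·_λ m := x·m + λμ(x,m), m·_λ x := m·x + λν(m,x), with the original hom maps α, α_M, define a left Hom-Leibniz algebra in LM. -/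
set_option maxHeartbeats 2000000
set_option linter.unusedSimpArgs false


/-- A Nijenhuis operator `(N₀, N₁)` on a left Hom-Leibniz algebra
`(M, g, f)` in `LM` generates a deformation: for every `λ`, the deformed operations
define a left Hom-Leibniz algebra in `LM`. -/
theorem nijenhuis_generates_deformation
    {k g M : Type*} [Field k] [CharZero k]
    [AddCommGroup g] [Module k g] [AddCommGroup M] [Module k M]
    (mul : g →ₗ[k] g →ₗ[k] g) (α : g →ₗ[k] g)
    (la : g →ₗ[k] M →ₗ[k] M) (ra : M →ₗ[k] g →ₗ[k] M) (αM : M →ₗ[k] M)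
    (f : M →ₗ[k] g)
    (hlm : IsLMHomLeibniz (fun x y => mul x y) ⇑α
      (fun x m => la x m) (fun m x => ra m x) ⇑αM ⇑f)
    (N₀ : g →ₗ[k] g) (N₁ : M →ₗ[k] M)
    (hN₀α : ∀ x, α (N₀ x) = N₀ (α x)) (hN₁α : ∀ m, αM (N₁ m) = N₁ (αM m))
    -- Nijenhuis conditions (i)–(iv)
    (hNij1 : ∀ m : M, N₀ (f (N₁ m) - N₀ (f m)) = 0)
    (hNij2 : ∀ x y : g,
      N₀ (mul (N₀ x) y + mul x (N₀ y) - N₀ (mul x y)) = mul (N₀ x) (N₀ y))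
    (hNij3 : ∀ (x : g) (m : M),
      N₁ (la (N₀ x) m + la x (N₁ m) - N₁ (la x m)) = la (N₀ x) (N₁ m))
    (hNij4 : ∀ (m : M) (x : g),
      N₁ (ra (N₁ m) x + ra m (N₀ x) - N₁ (ra m x)) = ra (N₁ m) (N₀ x)) :
    ∀ lam : k, IsLMHomLeibniz
      (fun x y => mul x y + lam • (mul (N₀ x) y + mul x (N₀ y) - N₀ (mul x y))) ⇑α
      (fun x m => la x m + lam • (la (N₀ x) m + la x (N₁ m) - N₁ (la x m)))
      (fun m x => ra m x + lam • (ra m (N₀ x) + ra (N₁ m) x - N₁ (ra m x))) ⇑αM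
      (fun m => f m + lam • (f (N₁ m) - N₀ (f m))) := by
  obtain ⟨hL, ⟨hA, hB, h1, h2, h3⟩, hf, hfl, hfr⟩ := hlm
  unfold IsLeftHomLeibniz at hL
  simp only [map_sub, map_add] at hNij1 hNij2 hNij3 hNij4
  have hNij1' : ∀ m, N₀ (f (N₁ m)) = N₀ (N₀ (f m)) := fun m => sub_eq_zero.mp (hNij1 m)
  simp only at hL hA hB h1 h2 h3 hfl hfr
  intro lam
  refine ⟨fun x y z => ?_, ⟨fun x m => ?_, fun m x => ?_, fun x y m => ?_, fun m x y => ?_, fun x m y => ?_⟩,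
    fun m => ?_, fun x m => ?_, fun m x => ?_⟩
  all_goals beta_reduce
  · have e0 := hL x y z
    have e1 := hL (N₀ x) y z
    have e2 := hL x (N₀ y) z
    have e3 := hL x y (N₀ z)
    have e4 := hL (N₀ x) (N₀ y) z
    have e5 := hL (N₀ x) y (N₀ z)
    have e6 := hL x (N₀ y) (N₀ z)
    have e7 := congrArg N₀ e0
    have e8 := congrArg N₀ e1
    have e9 := congrArg N₀ e2
    have e10 := congrArg N₀ e3
    have e11 := congrArg N₀ e7
    simp only [map_sub, map_add, hN₀α, hN₁α] at e0 e1 e2 e3 e4 e5 e6 e7 e8 e9 e10 e11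
    have p0 := congrArg (mul (α x)) (hNij2 y z)
    have p1 := congrArg (fun t => mul t (α z)) (hNij2 x y)
    have p2 := congrArg (mul (α y)) (hNij2 x z)
    have p3 := hNij2 (α x) (mul y z)
    have p4 := hNij2 (mul x y) (α z)
    have p5 := hNij2 (α y) (mul x z)
    simp only [map_sub, map_add, LinearMap.sub_apply, LinearMap.add_apply] at p0 p1 p2 p3 p4 p5
    simp only [map_sub, map_add, map_smul, LinearMap.sub_apply, LinearMap.add_apply, LinearMap.smul_apply]
    linear_combination (norm := module) e0 + lam • (e1+e2+e3-e7) + (lam*lam) • (e4+e5+e6-e8-e9-e10+e11 + p0 - p1 - p2 + p3 - p4 - p5)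
  · simp only [map_sub, map_add, map_smul, LinearMap.sub_apply, LinearMap.add_apply, LinearMap.smul_apply, hN₀α, hN₁α, hA]
  · simp only [map_sub, map_add, map_smul, LinearMap.sub_apply, LinearMap.add_apply, LinearMap.smul_apply, hN₀α, hN₁α, hB]
  · have e0 := h1 x y m
    have e1 := h1 (N₀ x) y m
    have e2 := h1 x (N₀ y) m
    have e3 := h1 x y (N₁ m)
    have e4 := h1 (N₀ x) (N₀ y) m
    have e5 := h1 (N₀ x) y (N₁ m)
    have e6 := h1 x (N₀ y) (N₁ m)
    have e7 := congrArg N₁ e0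
    have e8 := congrArg N₁ e1
    have e9 := congrArg N₁ e2
    have e10 := congrArg N₁ e3
    have e11 := congrArg N₁ e7
    simp only [map_sub, map_add, hN₀α, hN₁α] at e0 e1 e2 e3 e4 e5 e6 e7 e8 e9 e10 e11
    have p0 := congrArg (la (α x)) (hNij3 y m)
    have p1 := congrArg (fun t => la t (αM m)) (hNij2 x y)
    have p2 := congrArg (la (α y)) (hNij3 x m)
    have p3 := hNij3 (α x) (la y m)
    have p4 := hNij3 (mul x y) (αM m)
    have p5 := hNij3 (α y) (la x m)
    simp only [map_sub, map_add, LinearMap.sub_apply, LinearMap.add_apply] at p0 p1 p2 p3 p4 p5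
    simp only [map_sub, map_add, map_smul, LinearMap.sub_apply, LinearMap.add_apply, LinearMap.smul_apply]
    linear_combination (norm := module) e0 + lam • (e1+e2+e3-e7) + (lam*lam) • (e4+e5+e6-e8-e9-e10+e11 + p0 - p1 - p2 + p3 - p4 - p5)
  · have e0 := h2 m x y
    have e1 := h2 (N₁ m) x y
    have e2 := h2 m (N₀ x) y
    have e3 := h2 m x (N₀ y)
    have e4 := h2 (N₁ m) (N₀ x) y
    have e5 := h2 (N₁ m) x (N₀ y)
    have e6 := h2 m (N₀ x) (N₀ y)
    have e7 := congrArg N₁ e0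
    have e8 := congrArg N₁ e1
    have e9 := congrArg N₁ e2
    have e10 := congrArg N₁ e3
    have e11 := congrArg N₁ e7
    simp only [map_sub, map_add, hN₀α, hN₁α] at e0 e1 e2 e3 e4 e5 e6 e7 e8 e9 e10 e11
    have p0 := congrArg (ra (αM m)) (hNij2 x y)
    have p1 := congrArg (fun t => ra t (α y)) (hNij4 m x)
    have p2 := congrArg (la (α x)) (hNij4 m y)
    have p3 := hNij4 (αM m) (mul x y)
    have p4 := hNij4 (ra m x) (α y)
    have p5 := hNij3 (α x) (ra m y)
    simp only [map_sub, map_add, LinearMap.sub_apply, LinearMap.add_apply] at p0 p1 p2 p3 p4 p5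
    simp only [map_sub, map_add, map_smul, LinearMap.sub_apply, LinearMap.add_apply, LinearMap.smul_apply]
    linear_combination (norm := module) e0 + lam • (e1+e2+e3-e7) + (lam*lam) • (e4+e5+e6-e8-e9-e10+e11 + p0 - p1 - p2 + p3 - p4 - p5)
  · have e0 := h3 x m y
    have e1 := h3 (N₀ x) m y
    have e2 := h3 x (N₁ m) y
    have e3 := h3 x m (N₀ y)
    have e4 := h3 (N₀ x) (N₁ m) y
    have e5 := h3 (N₀ x) m (N₀ y)
    have e6 := h3 x (N₁ m) (N₀ y)
    have e7 := congrArg N₁ e0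
    have e8 := congrArg N₁ e1
    have e9 := congrArg N₁ e2
    have e10 := congrArg N₁ e3
    have e11 := congrArg N₁ e7
    simp only [map_sub, map_add, hN₀α, hN₁α] at e0 e1 e2 e3 e4 e5 e6 e7 e8 e9 e10 e11
    have p0 := congrArg (la (α x)) (hNij4 m y)
    have p1 := congrArg (fun t => ra t (α y)) (hNij3 x m)
    have p2 := congrArg (ra (αM m)) (hNij2 x y)
    have p3 := hNij3 (α x) (ra m y)
    have p4 := hNij4 (la x m) (α y)
    have p5 := hNij4 (αM m) (mul x y)
    simp only [map_sub, map_add, LinearMap.sub_apply, LinearMap.add_apply] at p0 p1 p2 p3 p4 p5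
    simp only [map_sub, map_add, map_smul, LinearMap.sub_apply, LinearMap.add_apply, LinearMap.smul_apply]
    linear_combination (norm := module) e0 + lam • (e1+e2+e3-e7) + (lam*lam) • (e4+e5+e6-e8-e9-e10+e11 + p0 - p1 - p2 + p3 - p4 - p5)
  · simp only [map_sub, map_add, map_smul, LinearMap.sub_apply, LinearMap.add_apply, LinearMap.smul_apply, hN₀α, hN₁α, hf]
  · have q1 := congrArg f (hNij3 x m)
    have q2 := hNij2 x (f m)
    simp only [map_sub, map_add, hfl, hfr] at q1 q2
    simp only [map_sub, map_add, map_smul, LinearMap.sub_apply, LinearMap.add_apply, LinearMap.smul_apply, hN₀α, hN₁α, hfl, hfr, hNij1']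
    linear_combination (norm := module) (lam*lam) • (q1 - q2)
  · have q1 := congrArg f (hNij4 m x)
    have q2 := hNij2 (f m) x
    simp only [map_sub, map_add, hfl, hfr] at q1 q2
    simp only [map_sub, map_add, map_smul, LinearMap.sub_apply, LinearMap.add_apply, LinearMap.smul_apply, hN₀α, hN₁α, hfl, hfr, hNij1']
    linear_combination (norm := module) (lam*lam) • (q1 - q2)
end

section
/- Let (M, g, f) be a left Hom-Leibniz algebra in LM over a field k of characteristic 0 and let (N₀, N₁) be a Nijenhuis operator with α∘N₀ = N₀∘α and α_M∘N₁ = N₁∘α_M. Let (f_λ, ·_λ) be the deformed structure determined by θ := f∘N₁ − N₀∘f, ω(x,y) := N₀(x)y + xN₀(y) − N₀(xy), μ(x,m) := N₀(x)·m + x·N₁(m) − N₁(x·m), ν(m,x) := m·N₀(x) + N₁(m)·x − N₁(m·x). Then the deformation is trivial: for every λ ∈ k, the maps T₀ := id_g + λN₀ and T₁ := id_M + λN₁ satisfy f∘T₁ = T₀∘f_λ, T₀(x·_λ y) = T₀(x)T₀(y), T₁(x·_λ m) = T₀(x)·T₁(m), and T₁(m·_λ x) = T₁(m)·T₀(x)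 for all x, y ∈ g, m ∈ M. -/
/-- The deformation generated by a Nijenhuis operator `(N₀, N₁)` is
trivial: `T₀ = id + λN₀` and `T₁ = id + λN₁` form a morphism from the deformed structure
to the original one. -/
theorem nijenhuis_deformation_is_trivial
    {k g M : Type*} [Field k] [CharZero k]
    [AddCommGroup g] [Module k g] [AddCommGroup M] [Module k M]
    (mul : g →ₗ[k] g →ₗ[k] g) (α : g →ₗ[k] g)
    (la : g →ₗ[k] M →ₗ[k] M) (ra : M →ₗ[k] g →ₗ[k] M) (αM : M →ₗ[k] M)
    (f : M →ₗ[k] g)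
    (hlm : IsLMHomLeibniz (fun x y => mul x y) ⇑α
      (fun x m => la x m) (fun m x => ra m x) ⇑αM ⇑f)
    (N₀ : g →ₗ[k] g) (N₁ : M →ₗ[k] M)
    (hN₀α : ∀ x, α (N₀ x) = N₀ (α x)) (hN₁α : ∀ m, αM (N₁ m) = N₁ (αM m))
    -- Nijenhuis conditions (i)–(iv)
    (hNij1 : ∀ m : M, N₀ (f (N₁ m) - N₀ (f m)) = 0)
    (hNij2 : ∀ x y : g,
      N₀ (mul (N₀ x) y + mul x (N₀ y) - N₀ (mul x y)) = mul (N₀ x) (N₀ y))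
    (hNij3 : ∀ (x : g) (m : M),
      N₁ (la (N₀ x) m + la x (N₁ m) - N₁ (la x m)) = la (N₀ x) (N₁ m))
    (hNij4 : ∀ (m : M) (x : g),
      N₁ (ra (N₁ m) x + ra m (N₀ x) - N₁ (ra m x)) = ra (N₁ m) (N₀ x)) :
    ∀ lam : k,
      -- `f ∘ T₁ = T₀ ∘ f_λ`
      (∀ m : M,
        f (m + lam • N₁ m)
          = (f m + lam • (f (N₁ m) - N₀ (f m)))
            + lam • N₀ (f m + lam • (f (N₁ m) - N₀ (f m)))) ∧
      -- `T₀(x ·_λ y) = T₀(x) T₀(y)`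
      (∀ x y : g,
        (mul x y + lam • (mul (N₀ x) y + mul x (N₀ y) - N₀ (mul x y)))
            + lam • N₀ (mul x y + lam • (mul (N₀ x) y + mul x (N₀ y) - N₀ (mul x y)))
          = mul (x + lam • N₀ x) (y + lam • N₀ y)) ∧
      -- `T₁(x ·_λ m) = T₀(x) · T₁(m)`
      (∀ (x : g) (m : M),
        (la x m + lam • (la (N₀ x) m + la x (N₁ m) - N₁ (la x m)))
            + lam • N₁ (la x m + lam • (la (N₀ x) m + la x (N₁ m) - N₁ (la x m)))
          = la (x + lam • N₀ x) (m + lam • N₁ m)) ∧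
      -- `T₁(m ·_λ x) = T₁(m) · T₀(x)`
      (∀ (m : M) (x : g),
        (ra m x + lam • (ra m (N₀ x) + ra (N₁ m) x - N₁ (ra m x)))
            + lam • N₁ (ra m x + lam • (ra m (N₀ x) + ra (N₁ m) x - N₁ (ra m x)))
          = ra (m + lam • N₁ m) (x + lam • N₀ x)) := by
  intro lam
  refine ⟨fun m => ?_, fun x y => ?_, fun x m => ?_, fun m x => ?_⟩
  · rw [map_add N₀, map_smul N₀, hNij1]
    simp only [map_add, map_smul]
    module
  · rw [map_add N₀, map_smul N₀, hNij2]
    simp only [map_add, map_smul, LinearMap.add_apply, LinearMap.smul_apply]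
    module
  · rw [map_add N₁, map_smul N₁, hNij3]
    simp only [map_add, map_smul, LinearMap.add_apply, LinearMap.smul_apply]
    module
  · rw [map_add N₁, map_smul N₁, add_comm (ra m (N₀ x)), hNij4]
    simp only [map_add, map_smul, LinearMap.add_apply, LinearMap.smul_apply]
    module
end

section
/- Let (M, g, f) be a left Hom-Leibniz algebra in LM over a field k of characteristic 0, and let (ω_i, μ_i, ν_i, θ_i)_{i≥0} and (ω'_i, μ'_i, ν'_i, θ'_i)_{i≥0} be two formal deformations of (M, g, f). Suppose they are equivalent via sequences of linear maps (ψ_i : g → g)_{i≥0}, (φ_i : M → M)_{i≥0} with ψ₀ = id_g, φ₀ = id_M, satisfying for every k ≥ 0 and all x, y ∈ g, m ∈ M: Σ_{i+j=k} ψ_i(ω'_j(x,y)) = Σ_{i+j+l=k} ω_i(ψ_j(x), ψ_l(y)); Σ_{i+j=k} φ_i(μ'_j(x,m)) = Σ_{i+j+l=k} μ_i(ψ_j(x), φ_l(m)); Σ_{i+j=k} φ_i(ν'_j(m,x)) = Σ_{i+j+l=k} ν_i(φ_j(m), ψ_l(x)); Σ_{i+j=k} ψ_i(θ'_j(m)) =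 Σ_{i+j=k} θ_i(φ_j(m)). Then the first-order terms differ by the coboundary of the 1-cochain (ψ₁, φ₁): ω'₁(x,y) − ω₁(x,y) = ψ₁(x)y + xψ₁(y) − ψ₁(xy); μ'₁(x,m) − μ₁(x,m) = ψ₁(x)·m + x·φ₁(m) − φ₁(x·m); ν'₁(m,x) − ν₁(m,x) = φ₁(m)·x + m·ψ₁(x) − φ₁(m·x); θ'₁(m) − θ₁(m) = f(φ₁(m)) − ψ₁(f(m)). -/
/-- Equivalent formal deformations of a left Hom-Leibniz algebra
`(M, g, f)` in `LM` have first-order terms differing by the coboundary of the 1-cochain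
`(ψ₁, φ₁)`. -/
theorem equivalent_deformations_first_order_terms
    {k g M : Type*} [Field k] [CharZero k]
    [AddCommGroup g] [Module k g] [AddCommGroup M] [Module k M]
    (mul : g →ₗ[k] g →ₗ[k] g) (α : g →ₗ[k] g)
    (la : g →ₗ[k] M →ₗ[k] M) (ra : M →ₗ[k] g →ₗ[k] M) (αM : M →ₗ[k] M)
    (f : M →ₗ[k] g)
    (hlm : IsLMHomLeibniz (fun x y => mul x y) ⇑α
      (fun x m => la x m) (fun m x => ra m x) ⇑αM ⇑f)
    -- two formal deformations
    (ω : ℕ → g →ₗ[k] g →ₗ[k] g) (μ : ℕ → g →ₗ[k] M →ₗ[k] M)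
    (ν : ℕ → M →ₗ[k] g →ₗ[k] M) (θ : ℕ → M →ₗ[k] g)
    (ω' : ℕ → g →ₗ[k] g →ₗ[k] g) (μ' : ℕ → g →ₗ[k] M →ₗ[k] M)
    (ν' : ℕ → M →ₗ[k] g →ₗ[k] M) (θ' : ℕ → M →ₗ[k] g)
    (hdef : IsFormalDeformation (fun x y => mul x y) ⇑α
      (fun x m => la x m) (fun m x => ra m x) ⇑αM ⇑f
      (fun n x y => ω n x y) (fun n x m => μ n x m)
      (fun n m x => ν n m x) (fun n m => θ n m))
    (hdef' : IsFormalDeformation (fun x y => mul x y) ⇑α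
      (fun x m => la x m) (fun m x => ra m x) ⇑αM ⇑f
      (fun n x y => ω' n x y) (fun n x m => μ' n x m)
      (fun n m x => ν' n m x) (fun n m => θ' n m))
    -- which are equivalent via `(ψ_i)`, `(φ_i)`
    (ψ : ℕ → g →ₗ[k] g) (Φ : ℕ → M →ₗ[k] M)
    (hequiv : DeformationEquiv
      (fun n x y => ω n x y) (fun n x m => μ n x m)
      (fun n m x => ν n m x) (fun n m => θ n m)
      (fun n x y => ω' n x y) (fun n x m => μ' n x m)
      (fun n m x => ν' n m x) (fun n m => θ' n m)
      (fun n x => ψ n x) (fun n m => Φ n m)) :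
    -- the first-order terms differ by the coboundary of `(ψ₁, φ₁)`
    (∀ x y : g, ω' 1 x y - ω 1 x y = mul (ψ 1 x) y + mul x (ψ 1 y) - ψ 1 (mul x y)) ∧
    (∀ (x : g) (m : M),
      μ' 1 x m - μ 1 x m = la (ψ 1 x) m + la x (Φ 1 m) - Φ 1 (la x m)) ∧
    (∀ (m : M) (x : g),
      ν' 1 m x - ν 1 m x = ra (Φ 1 m) x + ra m (ψ 1 x) - Φ 1 (ra m x)) ∧
    (∀ m : M, θ' 1 m - θ 1 m = f (Φ 1 m) - ψ 1 (f m)) := by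
  obtain ⟨hω, hμ, hν, hθ, -⟩ := hdef
  obtain ⟨hω', hμ', hν', hθ', -⟩ := hdef'
  obtain ⟨hψ, hΦ, h1, h2, h3, h4⟩ := hequiv
  dsimp only at hω hμ hν hθ hω' hμ' hν' hθ' hψ hΦ h1 h2 h3 h4
  refine ⟨fun x y => ?_, fun x m => ?_, fun m x => ?_, fun m => ?_⟩
  · have h := h1 1 x y
    simp only [Finset.Nat.antidiagonal_succ, Finset.Nat.antidiagonal_zero, Finset.sum_cons,
      Finset.map_singleton, Finset.sum_singleton, Function.Embedding.prodMap,
      Function.Embedding.coeFn_mk, Prod.map, Function.Embedding.refl_apply, Nat.succ_eq_add_one,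
      zero_add, hψ, hω, hω'] at h
    rw [sub_eq_sub_iff_add_eq_add, h]
    abel
  · have h := h2 1 x m
    simp only [Finset.Nat.antidiagonal_succ, Finset.Nat.antidiagonal_zero, Finset.sum_cons,
      Finset.map_singleton, Finset.sum_singleton, Function.Embedding.prodMap,
      Function.Embedding.coeFn_mk, Prod.map, Function.Embedding.refl_apply, Nat.succ_eq_add_one,
      zero_add, hψ, hΦ, hμ, hμ'] at h
    rw [sub_eq_sub_iff_add_eq_add, h]
    abel
  · have h := h3 1 m x
    simp only [Finset.Nat.antidiagonal_succ, Finset.Nat.antidiagonal_zero, Finset.sum_cons,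
      Finset.map_singleton, Finset.sum_singleton, Function.Embedding.prodMap,
      Function.Embedding.coeFn_mk, Prod.map, Function.Embedding.refl_apply, Nat.succ_eq_add_one,
      zero_add, hψ, hΦ, hν, hν'] at h
    rw [sub_eq_sub_iff_add_eq_add, h]
    abel
  · have h := h4 1 m
    simp only [Finset.Nat.antidiagonal_succ, Finset.Nat.antidiagonal_zero, Finset.sum_cons,
      Finset.map_singleton, Finset.sum_singleton, Function.Embedding.prodMap,
      Function.Embedding.coeFn_mk, Prod.map, Function.Embedding.refl_apply, Nat.succ_eq_add_one,
      zero_add, hψ, hΦ, hθ, hθ'] at h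
    rw [sub_eq_sub_iff_add_eq_add, h]
end

section
/- Let (M̂, ĝ, f̂) be an abelian extension of the left Hom-Leibniz algebra (M, g, f) in LM, with W = ker p₀, V = ker p₁, and let (σ₀, σ₁) be a splitting. Define θ(m) := f̂(σ₁(m)) − σ₀(f(m)), ω(x,y) := σ₀(x)σ₀(y) − σ₀(xy), μ(x,m) := σ₀(x)·σ₁(m) − σ₁(x·m), ν(m,x) := σ₁(m)·σ₀(x) − σ₁(m·x). Then θ takes values in W, ω takes values in W, μ and ν take values in V, and (ω, μ, ν, θ) is a 2-cocycle of (M, g, f) with coefficients in the induced bimodule (V, W, φ), where φ := f̂|_V, x·w := σ₀(x)w, w·x := wσ₀(x), x·v := σ₀(x)·v, v·x := v·σ₀(x), w▷m := w·σ₁(m), m◁w := σ₁(m)·w; i.e., the six cocycle identities (C1)–(C6) hold. -/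
/-- A splitting of an abelian extension of a left Hom-Leibniz algebra
`(M, g, f)` in `LM` induces a 2-cocycle `(ω, μ, ν, θ)` with coefficients in the induced
bimodule `(V, W, φ) = (ker p₁, ker p₀, f̂|)`. -/
theorem abelian_extension_gives_two_cocycle
    {k g M gh Mh : Type*} [Field k] [CharZero k]
    [AddCommGroup g] [Module k g] [AddCommGroup M] [Module k M]
    [AddCommGroup gh] [Module k gh] [AddCommGroup Mh] [Module k Mh]
    -- the base left Hom-Leibniz algebra `(M, g, f)` in `LM`
    (mul : g →ₗ[k] g →ₗ[k] g) (α : g →ₗ[k] g)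
    (la : g →ₗ[k] M →ₗ[k] M) (ra : M →ₗ[k] g →ₗ[k] M) (αM : M →ₗ[k] M)
    (f : M →ₗ[k] g)
    (hlm : IsLMHomLeibniz (fun x y => mul x y) ⇑α
      (fun x m => la x m) (fun m x => ra m x) ⇑αM ⇑f)
    -- the extension `(M̂, ĝ, f̂)`, also a left Hom-Leibniz algebra in `LM`
    (mulh : gh →ₗ[k] gh →ₗ[k] gh) (αh : gh →ₗ[k] gh)
    (lah : gh →ₗ[k] Mh →ₗ[k] Mh) (rah : Mh →ₗ[k] gh →ₗ[k] Mh) (αMh : Mh →ₗ[k] Mh)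
    (fh : Mh →ₗ[k] gh)
    (hlmh : IsLMHomLeibniz (fun a b => mulh a b) ⇑αh
      (fun a u => lah a u) (fun u a => rah u a) ⇑αMh ⇑fh)
    -- the surjective structure-preserving projections
    (p₀ : gh →ₗ[k] g) (p₁ : Mh →ₗ[k] M)
    (hp₀surj : Function.Surjective ⇑p₀) (hp₁surj : Function.Surjective ⇑p₁)
    (hpα : ∀ a, p₀ (αh a) = α (p₀ a)) (hpαM : ∀ u, p₁ (αMh u) = αM (p₁ u))
    (hpmul : ∀ a b, p₀ (mulh a b) = mul (p₀ a) (p₀ b))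
    (hpla : ∀ a u, p₁ (lah a u) = la (p₀ a) (p₁ u))
    (hpra : ∀ u a, p₁ (rah u a) = ra (p₁ u) (p₀ a))
    (hpf : ∀ u, p₀ (fh u) = f (p₁ u))
    -- the extension is abelian
    (habmul : ∀ a b, p₀ a = 0 → p₀ b = 0 → mulh a b = 0)
    (habla : ∀ a u, p₀ a = 0 → p₁ u = 0 → lah a u = 0)
    (habra : ∀ u a, p₁ u = 0 → p₀ a = 0 → rah u a = 0)
    -- a splitting
    (σ₀ : g →ₗ[k] gh) (σ₁ : M →ₗ[k] Mh)
    (hσ₀ : ∀ x, p₀ (σ₀ x) = x) (hσ₁ : ∀ m, p₁ (σ₁ m) = m)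
    (hσf : ∀ m, fh (σ₁ m) = σ₀ (f m))
    (hσα : ∀ x, αh (σ₀ x) = σ₀ (α x)) (hσαM : ∀ m, αMh (σ₁ m) = σ₁ (αM m)) :
    ∀ (θ : M → gh) (ω : g → g → gh) (μ : g → M → Mh) (ν : M → g → Mh),
      (∀ m, θ m = fh (σ₁ m) - σ₀ (f m)) →
      (∀ x y, ω x y = mulh (σ₀ x) (σ₀ y) - σ₀ (mul x y)) →
      (∀ x m, μ x m = lah (σ₀ x) (σ₁ m) - σ₁ (la x m)) →
      (∀ m x, ν m x = rah (σ₁ m) (σ₀ x) - σ₁ (ra m x)) →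
      -- `θ`, `ω` take values in `W = ker p₀`; `μ`, `ν` take values in `V = ker p₁`
      ((∀ m, p₀ (θ m) = 0) ∧ (∀ x y, p₀ (ω x y) = 0) ∧
       (∀ x m, p₁ (μ x m) = 0) ∧ (∀ m x, p₁ (ν m x) = 0)) ∧
      -- `(ω, μ, ν, θ)` is a 2-cocycle with coefficients in the induced bimodule
      IsTwoCocycle (fun x y => mul x y) ⇑α
        (fun x m => la x m) (fun m x => ra m x) ⇑αM ⇑f
        (fun x w => mulh (σ₀ x) w) (fun w x => mulh w (σ₀ x))
        (fun x v => lah (σ₀ x) v) (fun v x => rah v (σ₀ x))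
        (fun w m => lah w (σ₁ m)) (fun m w => rah (σ₁ m) w) ⇑fh
        ω μ ν θ := by
  intro θ ω μ ν hθ hω hμ hν
  obtain ⟨hL, ⟨-, -, hB1, hB2, hB3⟩, -, hf1, hf2⟩ := hlm
  obtain ⟨hLh, ⟨-, -, hB1h, hB2h, hB3h⟩, -, hf1h, hf2h⟩ := hlmh
  simp only [IsLeftHomLeibniz] at hL hLh
  refine ⟨⟨?_, ?_, ?_, ?_⟩, ?_, ?_, ?_, ?_, ?_, ?_⟩
  · intro m
    simp [hθ, hpf, hσ₀, hσ₁]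
  · intro x y
    simp [hω, hpmul, hσ₀]
  · intro x m
    simp [hμ, hpla, hσ₀, hσ₁]
  · intro m x
    simp [hν, hpra, hσ₀, hσ₁]
  · intro x y z
    have h1 := hLh (σ₀ x) (σ₀ y) (σ₀ z)
    have h2 := congrArg σ₀ (hL x y z)
    simp only [hσα, map_add] at h1 h2
    simp only [hω, map_sub, LinearMap.sub_apply, h1, h2]
    abel
  · intro x y m
    have h1 := hB1h (σ₀ x) (σ₀ y) (σ₁ m)
    have h2 := congrArg σ₁ (hB1 x y m)
    simp only [hσα, hσαM, map_add] at h1 h2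
    simp only [hω, hμ, map_sub, LinearMap.sub_apply, h1, h2]
    abel
  · intro x y m
    have h1 := hB2h (σ₁ m) (σ₀ x) (σ₀ y)
    have h2 := congrArg σ₁ (hB2 m x y)
    simp only [hσα, hσαM, map_add] at h1 h2
    simp only [hω, hμ, hν, map_sub, LinearMap.sub_apply, h1, h2]
    abel
  · intro x y m
    have h1 := hB3h (σ₀ x) (σ₁ m) (σ₀ y)
    have h2 := congrArg σ₁ (hB3 x m y)
    simp only [hσα, hσαM, map_add] at h1 h2
    simp only [hω, hμ, hν, map_sub, LinearMap.sub_apply, h1, h2]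
    abel
  · intro x m
    have h1 := hf1h (σ₀ x) (σ₁ m)
    have h2 := hf1 x m
    simp only [hσf] at h1
    simp only [hθ, hω, hμ, map_sub, h1, h2, hσf]
    simp
  · intro m x
    have h1 := hf2h (σ₁ m) (σ₀ x)
    have h2 := hf2 m x
    simp only [hσf] at h1
    simp only [hθ, hω, hν, map_sub, h1, h2, hσf]
    simp
end

section
/- Let (M̂, ĝ, f̂) be an abelian extension of the left Hom-Leibniz algebra (M, g, f) in LM, with W = ker p₀ and V = ker p₁. Then the induced actions x·w := σ₀(x)w, w·x := wσ₀(x), x·v := σ₀(x)·v, v·x := v·σ₀(x), w▷m := w·σ₁(m), m◁w := σ₁(m)·w are all well-defined (x·w, w·x ∈ W; x·v, v·x, w▷m, m◁w ∈ V) and are independent of the choice of splitting: if (σ₀, σ₁) and (σ'₀, σ'₁) are any two splittings, then σ₀(x)w = σ'₀(x)w, wσ₀(x) = wσ'₀(x), σ₀(x)·v = σ'₀(x)·v, v·σ₀(x) = v·σ'₀(x), w·σ₁(m) = w·σ'₁(m), and σ₁(m)·w = σ'₁(m)·w, for all x ∈ g, m ∈ M, v ∈ V, w ∈ W. -/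
/-- The bimodule structure on `(V, W, φ) = (ker p₁, ker p₀, f̂|)` induced
by a splitting of an abelian extension is well defined (lands in the kernels) and is
independent of the choice of splitting. -/
theorem induced_bimodule_well_defined_and_independent_of_splitting
    {k g M gh Mh : Type*} [Field k] [CharZero k]
    [AddCommGroup g] [Module k g] [AddCommGroup M] [Module k M]
    [AddCommGroup gh] [Module k gh] [AddCommGroup Mh] [Module k Mh]
    -- the base left Hom-Leibniz algebra `(M, g, f)` in `LM`
    (mul : g →ₗ[k] g →ₗ[k] g) (α : g →ₗ[k] g)
    (la : g →ₗ[k] M →ₗ[k] M) (ra : M →ₗ[k] g →ₗ[k] M) (αM : M →ₗ[k] M)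
    (f : M →ₗ[k] g)
    (hlm : IsLMHomLeibniz (fun x y => mul x y) ⇑α
      (fun x m => la x m) (fun m x => ra m x) ⇑αM ⇑f)
    -- the extension `(M̂, ĝ, f̂)`, also a left Hom-Leibniz algebra in `LM`
    (mulh : gh →ₗ[k] gh →ₗ[k] gh) (αh : gh →ₗ[k] gh)
    (lah : gh →ₗ[k] Mh →ₗ[k] Mh) (rah : Mh →ₗ[k] gh →ₗ[k] Mh) (αMh : Mh →ₗ[k] Mh)
    (fh : Mh →ₗ[k] gh)
    (hlmh : IsLMHomLeibniz (fun a b => mulh a b) ⇑αh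
      (fun a u => lah a u) (fun u a => rah u a) ⇑αMh ⇑fh)
    -- the surjective structure-preserving projections
    (p₀ : gh →ₗ[k] g) (p₁ : Mh →ₗ[k] M)
    (hp₀surj : Function.Surjective ⇑p₀) (hp₁surj : Function.Surjective ⇑p₁)
    (hpα : ∀ a, p₀ (αh a) = α (p₀ a)) (hpαM : ∀ u, p₁ (αMh u) = αM (p₁ u))
    (hpmul : ∀ a b, p₀ (mulh a b) = mul (p₀ a) (p₀ b))
    (hpla : ∀ a u, p₁ (lah a u) = la (p₀ a) (p₁ u))
    (hpra : ∀ u a, p₁ (rah u a) = ra (p₁ u) (p₀ a))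
    (hpf : ∀ u, p₀ (fh u) = f (p₁ u))
    -- the extension is abelian
    (habmul : ∀ a b, p₀ a = 0 → p₀ b = 0 → mulh a b = 0)
    (habla : ∀ a u, p₀ a = 0 → p₁ u = 0 → lah a u = 0)
    (habra : ∀ u a, p₁ u = 0 → p₀ a = 0 → rah u a = 0) :
    -- for any two splittings `(σ₀, σ₁)` and `(σ'₀, σ'₁)` ...
    ∀ (σ₀ σ₀' : g →ₗ[k] gh) (σ₁ σ₁' : M →ₗ[k] Mh),
      (∀ x, p₀ (σ₀ x) = x) → (∀ m, p₁ (σ₁ m) = m) →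
      (∀ m, fh (σ₁ m) = σ₀ (f m)) →
      (∀ x, αh (σ₀ x) = σ₀ (α x)) → (∀ m, αMh (σ₁ m) = σ₁ (αM m)) →
      (∀ x, p₀ (σ₀' x) = x) → (∀ m, p₁ (σ₁' m) = m) →
      (∀ m, fh (σ₁' m) = σ₀' (f m)) →
      (∀ x, αh (σ₀' x) = σ₀' (α x)) → (∀ m, αMh (σ₁' m) = σ₁' (αM m)) →
      ∀ (x : g) (m : M) (w : gh) (v : Mh), p₀ w = 0 → p₁ v = 0 →
        -- the induced actions land in `W = ker p₀` and `V = ker p₁`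
        (p₀ (mulh (σ₀ x) w) = 0 ∧ p₀ (mulh w (σ₀ x)) = 0 ∧
         p₁ (lah (σ₀ x) v) = 0 ∧ p₁ (rah v (σ₀ x)) = 0 ∧
         p₁ (lah w (σ₁ m)) = 0 ∧ p₁ (rah (σ₁ m) w) = 0) ∧
        -- and they do not depend on the choice of the splitting
        (mulh (σ₀ x) w = mulh (σ₀' x) w ∧
         mulh w (σ₀ x) = mulh w (σ₀' x) ∧
         lah (σ₀ x) v = lah (σ₀' x) v ∧
         rah v (σ₀ x) = rah v (σ₀' x) ∧
         lah w (σ₁ m) = lah w (σ₁' m) ∧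
         rah (σ₁ m) w = rah (σ₁' m) w) := by
  intro σ₀ σ₀' σ₁ σ₁' h0 h1 _ _ _ h0' h1' _ _ _ x m w v hw hv
  have d0 : p₀ (σ₀ x - σ₀' x) = 0 := by rw [map_sub, h0, h0', sub_self]
  have d1 : p₁ (σ₁ m - σ₁' m) = 0 := by rw [map_sub, h1, h1', sub_self]
  refine ⟨⟨?_, ?_, ?_, ?_, ?_, ?_⟩, ?_, ?_, ?_, ?_, ?_, ?_⟩
  · simp [hpmul, hw]
  · simp [hpmul, hw]
  · simp [hpla, hv]
  · simp [hpra, hv]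
  · simp [hpla, hw]
  · simp [hpra, hw]
  · have h := habmul _ _ d0 hw
    rwa [map_sub, LinearMap.sub_apply, sub_eq_zero] at h
  · have h := habmul _ _ hw d0
    rwa [map_sub, sub_eq_zero] at h
  · have h := habla _ _ d0 hv
    rwa [map_sub, LinearMap.sub_apply, sub_eq_zero] at h
  · have h := habra _ _ hv d0
    rwa [map_sub, sub_eq_zero] at h
  · have h := habla _ _ hw d1
    rwa [map_sub, sub_eq_zero] at h
  · have h := habra _ _ d1 hw
    rwa [map_sub, LinearMap.sub_apply, sub_eq_zero] at h
end

section
/- Let Ê (with projections p₀, p₁ and splitting (σ₀, σ₁)) and Ẽ (with projections q₀, q₁ and splitting (σ'₀, σ'₁)) be two abelian extensions of the left Hom-Leibniz algebra (M, g, f) in LM by the same (V, W, φ), and suppose they are equivalent via a morphism F = (F₀ : ĝ → g̃, F₁ : M̂ → M̃) of left Hom-Leibniz algebras in LM that restricts to the identity on W and on V and satisfies q₀∘F₀ = p₀, q₁∘F₁ = p₁. Let (ω, μ, ν, θ) and (ω', μ', ν', θ') be the 2-cocycles induced by the splittings. Then the linear maps b₀ : g → W, b₀(x) := F₀(σ₀(x))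 − σ'₀(x), and b₁ : M → V, b₁(m) := F₁(σ₁(m)) − σ'₁(m), satisfy θ(m) − θ'(m) = φ(b₁(m)) − b₀(f(m)); ω(x,y) − ω'(x,y) = x·b₀(y) + b₀(x)·y − b₀(xy); μ(x,m) − μ'(x,m) = x·b₁(m) + b₀(x)▷m − b₁(x·m); ν(m,x) − ν'(m,x) = b₁(m)·x + m◁b₀(x) − b₁(m·x); that is, the two 2-cocycles differ by the coboundary of the 1-cochain (b₀, b₁). -/
/-- Two equivalent abelian extensions of a left Hom-Leibniz algebra
`(M, g, f)` in `LM` by the same `(V, W, φ)` induce 2-cocycles which differ by the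
coboundary of the 1-cochain `(b₀, b₁)` built from the equivalence and the splittings. -/
theorem equivalent_extensions_cocycles_cohomologous
    {k g M gh Mh gt Mt W V : Type*} [Field k] [CharZero k]
    [AddCommGroup g] [Module k g] [AddCommGroup M] [Module k M]
    [AddCommGroup gh] [Module k gh] [AddCommGroup Mh] [Module k Mh]
    [AddCommGroup gt] [Module k gt] [AddCommGroup Mt] [Module k Mt]
    [AddCommGroup W] [Module k W] [AddCommGroup V] [Module k V]
    -- the base left Hom-Leibniz algebra `(M, g, f)` in `LM`
    (mul : g →ₗ[k] g →ₗ[k] g) (α : g →ₗ[k] g)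
    (la : g →ₗ[k] M →ₗ[k] M) (ra : M →ₗ[k] g →ₗ[k] M) (αM : M →ₗ[k] M)
    (f : M →ₗ[k] g)
    (hlm : IsLMHomLeibniz (fun x y => mul x y) ⇑α
      (fun x m => la x m) (fun m x => ra m x) ⇑αM ⇑f)
    -- the extension `Ê = (M̂, ĝ, f̂)`
    (mulh : gh →ₗ[k] gh →ₗ[k] gh) (αh : gh →ₗ[k] gh)
    (lah : gh →ₗ[k] Mh →ₗ[k] Mh) (rah : Mh →ₗ[k] gh →ₗ[k] Mh) (αMh : Mh →ₗ[k] Mh)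
    (fh : Mh →ₗ[k] gh)
    (hlmh : IsLMHomLeibniz (fun a b => mulh a b) ⇑αh
      (fun a u => lah a u) (fun u a => rah u a) ⇑αMh ⇑fh)
    (p₀ : gh →ₗ[k] g) (p₁ : Mh →ₗ[k] M)
    (hp₀surj : Function.Surjective ⇑p₀) (hp₁surj : Function.Surjective ⇑p₁)
    (hpα : ∀ a, p₀ (αh a) = α (p₀ a)) (hpαM : ∀ u, p₁ (αMh u) = αM (p₁ u))
    (hpmul : ∀ a b, p₀ (mulh a b) = mul (p₀ a) (p₀ b))
    (hpla : ∀ a u, p₁ (lah a u) = la (p₀ a) (p₁ u))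
    (hpra : ∀ u a, p₁ (rah u a) = ra (p₁ u) (p₀ a))
    (hpf : ∀ u, p₀ (fh u) = f (p₁ u))
    (habmulh : ∀ a b, p₀ a = 0 → p₀ b = 0 → mulh a b = 0)
    (hablah : ∀ a u, p₀ a = 0 → p₁ u = 0 → lah a u = 0)
    (habrah : ∀ u a, p₁ u = 0 → p₀ a = 0 → rah u a = 0)
    -- the extension `Ẽ = (M̃, g̃, f̃)`
    (mult : gt →ₗ[k] gt →ₗ[k] gt) (αt : gt →ₗ[k] gt)
    (lat : gt →ₗ[k] Mt →ₗ[k] Mt) (rat : Mt →ₗ[k] gt →ₗ[k] Mt) (αMt : Mt →ₗ[k] Mt)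
    (ft : Mt →ₗ[k] gt)
    (hlmt : IsLMHomLeibniz (fun a b => mult a b) ⇑αt
      (fun a u => lat a u) (fun u a => rat u a) ⇑αMt ⇑ft)
    (q₀ : gt →ₗ[k] g) (q₁ : Mt →ₗ[k] M)
    (hq₀surj : Function.Surjective ⇑q₀) (hq₁surj : Function.Surjective ⇑q₁)
    (hqα : ∀ a, q₀ (αt a) = α (q₀ a)) (hqαM : ∀ u, q₁ (αMt u) = αM (q₁ u))
    (hqmul : ∀ a b, q₀ (mult a b) = mul (q₀ a) (q₀ b))
    (hqla : ∀ a u, q₁ (lat a u) = la (q₀ a) (q₁ u))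
    (hqra : ∀ u a, q₁ (rat u a) = ra (q₁ u) (q₀ a))
    (hqf : ∀ u, q₀ (ft u) = f (q₁ u))
    (habmult : ∀ a b, q₀ a = 0 → q₀ b = 0 → mult a b = 0)
    (hablat : ∀ a u, q₀ a = 0 → q₁ u = 0 → lat a u = 0)
    (habrat : ∀ u a, q₁ u = 0 → q₀ a = 0 → rat u a = 0)
    -- both extensions are by the same `(V, W, φ)`
    (ι₀ : W →ₗ[k] gh) (ι₁ : V →ₗ[k] Mh) (ι₀' : W →ₗ[k] gt) (ι₁' : V →ₗ[k] Mt)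
    (hι₀inj : Function.Injective ⇑ι₀) (hι₁inj : Function.Injective ⇑ι₁)
    (hι₀'inj : Function.Injective ⇑ι₀') (hι₁'inj : Function.Injective ⇑ι₁')
    (hexact₀ : ∀ a : gh, p₀ a = 0 ↔ a ∈ Set.range ⇑ι₀)
    (hexact₁ : ∀ u : Mh, p₁ u = 0 ↔ u ∈ Set.range ⇑ι₁)
    (hexact₀' : ∀ a : gt, q₀ a = 0 ↔ a ∈ Set.range ⇑ι₀')
    (hexact₁' : ∀ u : Mt, q₁ u = 0 ↔ u ∈ Set.range ⇑ι₁')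
    (φ : V →ₗ[k] W)
    (hφh : ∀ v, fh (ι₁ v) = ι₀ (φ v)) (hφt : ∀ v, ft (ι₁' v) = ι₀' (φ v))
    -- an equivalence `F = (F₀, F₁)` of abelian extensions
    (F₀ : gh →ₗ[k] gt) (F₁ : Mh →ₗ[k] Mt)
    (hFα : ∀ a, F₀ (αh a) = αt (F₀ a)) (hFαM : ∀ u, F₁ (αMh u) = αMt (F₁ u))
    (hFmul : ∀ a b, F₀ (mulh a b) = mult (F₀ a) (F₀ b))
    (hFla : ∀ a u, F₁ (lah a u) = lat (F₀ a) (F₁ u))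
    (hFra : ∀ u a, F₁ (rah u a) = rat (F₁ u) (F₀ a))
    (hFf : ∀ u, ft (F₁ u) = F₀ (fh u))
    (hFW : ∀ w, F₀ (ι₀ w) = ι₀' w) (hFV : ∀ v, F₁ (ι₁ v) = ι₁' v)
    (hFp : ∀ a, q₀ (F₀ a) = p₀ a) (hFq : ∀ u, q₁ (F₁ u) = p₁ u)
    -- splittings of the two extensions
    (σ₀ : g →ₗ[k] gh) (σ₁ : M →ₗ[k] Mh)
    (hσ₀ : ∀ x, p₀ (σ₀ x) = x) (hσ₁ : ∀ m, p₁ (σ₁ m) = m)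
    (hσf : ∀ m, fh (σ₁ m) = σ₀ (f m))
    (hσα : ∀ x, αh (σ₀ x) = σ₀ (α x)) (hσαM : ∀ m, αMh (σ₁ m) = σ₁ (αM m))
    (σ₀' : g →ₗ[k] gt) (σ₁' : M →ₗ[k] Mt)
    (hσ₀' : ∀ x, q₀ (σ₀' x) = x) (hσ₁' : ∀ m, q₁ (σ₁' m) = m)
    (hσf' : ∀ m, ft (σ₁' m) = σ₀' (f m))
    (hσα' : ∀ x, αt (σ₀' x) = σ₀' (α x)) (hσαM' : ∀ m, αMt (σ₁' m) = σ₁' (αM m)) :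
    -- the 1-cochain `(b₀, b₁)` defined by `b₀ = F₀∘σ₀ − σ'₀`, `b₁ = F₁∘σ₁ − σ'₁`
    ∀ (b₀ : g → gt) (b₁ : M → Mt),
      (∀ x, b₀ x = F₀ (σ₀ x) - σ₀' x) → (∀ m, b₁ m = F₁ (σ₁ m) - σ₁' m) →
      -- takes values in `W` and `V` respectively ...
      (∀ x, q₀ (b₀ x) = 0) ∧ (∀ m, q₁ (b₁ m) = 0) ∧
      -- `θ − θ' = φ(b₁) − b₀∘f`
      (∀ m, F₀ (fh (σ₁ m) - σ₀ (f m)) - (ft (σ₁' m) - σ₀' (f m))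
          = ft (b₁ m) - b₀ (f m)) ∧
      -- `ω − ω' = x·b₀(y) + b₀(x)·y − b₀(xy)`
      (∀ x y : g,
        F₀ (mulh (σ₀ x) (σ₀ y) - σ₀ (mul x y))
            - (mult (σ₀' x) (σ₀' y) - σ₀' (mul x y))
          = mult (σ₀' x) (b₀ y) + mult (b₀ x) (σ₀' y) - b₀ (mul x y)) ∧
      -- `μ − μ' = x·b₁(m) + b₀(x)▷m − b₁(x·m)`
      (∀ (x : g) (m : M),
        F₁ (lah (σ₀ x) (σ₁ m) - σ₁ (la x m))
            - (lat (σ₀' x) (σ₁' m) - σ₁' (la x m))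
          = lat (σ₀' x) (b₁ m) + lat (b₀ x) (σ₁' m) - b₁ (la x m)) ∧
      -- `ν − ν' = b₁(m)·x + m◁b₀(x) − b₁(m·x)`
      (∀ (m : M) (x : g),
        F₁ (rah (σ₁ m) (σ₀ x) - σ₁ (ra m x))
            - (rat (σ₁' m) (σ₀' x) - σ₁' (ra m x))
          = rat (b₁ m) (σ₀' x) + rat (σ₁' m) (b₀ x) - b₁ (ra m x)) := by
  intro b₀ b₁ hb₀ hb₁
  have k₀ : ∀ x, q₀ (b₀ x) = 0 := fun x => by
    rw [hb₀, map_sub, hFp, hσ₀, hσ₀', sub_self]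
  have k₁ : ∀ m, q₁ (b₁ m) = 0 := fun m => by
    rw [hb₁, map_sub, hFq, hσ₁, hσ₁', sub_self]
  have e₀ : ∀ x, F₀ (σ₀ x) = b₀ x + σ₀' x := fun x => by rw [hb₀]; abel
  have e₁ : ∀ m, F₁ (σ₁ m) = b₁ m + σ₁' m := fun m => by rw [hb₁]; abel
  refine ⟨k₀, k₁, fun m => ?_, fun x y => ?_, fun x m => ?_, fun m x => ?_⟩
  · rw [map_sub, ← hFf, e₀, e₁, map_add]
    abel
  · have h := habmult _ _ (k₀ x) (k₀ y)
    rw [map_sub, hFmul, e₀, e₀, e₀]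
    simp only [map_add, LinearMap.add_apply, h]
    abel
  · have h := hablat _ _ (k₀ x) (k₁ m)
    rw [map_sub, hFla, e₀, e₁, e₁]
    simp only [map_add, LinearMap.add_apply, h]
    abel
  · have h := habrat _ _ (k₁ m) (k₀ x)
    rw [map_sub, hFra, e₀, e₁, e₁]
    simp only [map_add, LinearMap.add_apply, h]
    abel
end

section
/- Let (M, g, f) be a left Hom-Leibniz algebra in LM, (V, W, φ) a bimodule of (M, g, f), and let (ω, μ, ν, θ) and (ω', μ', ν', θ') be two hom-compatible 2-cocycles with coefficients in (V, W, φ) that are cohomologous, i.e. there exist linear maps b₀ : g → W and b₁ : M → V (commuting with the hom maps) with θ(m) − θ'(m) = φ(b₁(m)) − b₀(f(m)), ω(x,y) − ω'(x,y) = x·b₀(y) + b₀(x)·y − b₀(xy), μ(x,m) − μ'(x,m) = x·b₁(m) + b₀(x)▷m − b₁(x·m), ν(m,x) − ν'(m,x) = b₁(m)·x + m◁b₀(x) − b₁(m·x). Then the two abelian extensions built on (M ⊕ V, g ⊕ W) from these cocycles are equivalent: the maps F₀(x + w) := x + b₀(x) + w and F₁(m + v) := m + b₁(m) + v form a morphism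 of left Hom-Leibniz algebras in LM from the extension determined by (ω, μ, ν, θ) to the extension determined by (ω', μ', ν', θ') that commutes with the inclusions of (V, W, φ) and the projections onto (M, g, f). -/
/-- Cohomologous hom-compatible 2-cocycles give equivalent abelian
extensions on `(M ⊕ V, g ⊕ W)`: the maps `F₀(x + w) = x + b₀(x) + w`,
`F₁(m + v) = m + b₁(m) + v` form a morphism of left Hom-Leibniz algebras in `LM`
commuting with the inclusions and the projections. -/
theorem cohomologous_cocycles_give_equivalent_extensions
    {k g M W V : Type*} [Field k] [CharZero k]
    [AddCommGroup g] [Module k g] [AddCommGroup M] [Module k M]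
    [AddCommGroup W] [Module k W] [AddCommGroup V] [Module k V]
    (mul : g →ₗ[k] g →ₗ[k] g) (α : g →ₗ[k] g)
    (la : g →ₗ[k] M →ₗ[k] M) (ra : M →ₗ[k] g →ₗ[k] M) (αM : M →ₗ[k] M)
    (f : M →ₗ[k] g)
    (laW : g →ₗ[k] W →ₗ[k] W) (raW : W →ₗ[k] g →ₗ[k] W) (αW : W →ₗ[k] W)
    (laV : g →ₗ[k] V →ₗ[k] V) (raV : V →ₗ[k] g →ₗ[k] V) (αV : V →ₗ[k] V)
    (tr : W →ₗ[k] M →ₗ[k] V) (tl : M →ₗ[k] W →ₗ[k] V) (φ : V →ₗ[k] W)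
    (hlm : IsLMHomLeibniz (fun x y => mul x y) ⇑α
      (fun x m => la x m) (fun m x => ra m x) ⇑αM ⇑f)
    (hbim : IsLMBimodule (fun x y => mul x y) ⇑α
      (fun x m => la x m) (fun m x => ra m x) ⇑αM ⇑f
      (fun x w => laW x w) (fun w x => raW w x) ⇑αW
      (fun x v => laV x v) (fun v x => raV v x) ⇑αV
      (fun w m => tr w m) (fun m w => tl m w) ⇑φ)
    -- two hom-compatible 2-cocycles
    (ω ω' : g →ₗ[k] g →ₗ[k] W) (μ μ' : g →ₗ[k] M →ₗ[k] V)
    (ν ν' : M →ₗ[k] g →ₗ[k] V) (θ θ' : M →ₗ[k] W)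
    (hωα : ∀ x y, αW (ω x y) = ω (α x) (α y))
    (hμα : ∀ x m, αV (μ x m) = μ (α x) (αM m))
    (hνα : ∀ m x, αV (ν m x) = ν (αM m) (α x))
    (hθα : ∀ m, αW (θ m) = θ (αM m))
    (hωα' : ∀ x y, αW (ω' x y) = ω' (α x) (α y))
    (hμα' : ∀ x m, αV (μ' x m) = μ' (α x) (αM m))
    (hνα' : ∀ m x, αV (ν' m x) = ν' (αM m) (α x))
    (hθα' : ∀ m, αW (θ' m) = θ' (αM m))
    (hcoc : IsTwoCocycle (fun x y => mul x y) ⇑α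
      (fun x m => la x m) (fun m x => ra m x) ⇑αM ⇑f
      (fun x w => laW x w) (fun w x => raW w x)
      (fun x v => laV x v) (fun v x => raV v x)
      (fun w m => tr w m) (fun m w => tl m w) ⇑φ
      (fun x y => ω x y) (fun x m => μ x m) (fun m x => ν m x) ⇑θ)
    (hcoc' : IsTwoCocycle (fun x y => mul x y) ⇑α
      (fun x m => la x m) (fun m x => ra m x) ⇑αM ⇑f
      (fun x w => laW x w) (fun w x => raW w x)
      (fun x v => laV x v) (fun v x => raV v x)
      (fun w m => tr w m) (fun m w => tl m w) ⇑φ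
      (fun x y => ω' x y) (fun x m => μ' x m) (fun m x => ν' m x) ⇑θ')
    -- which are cohomologous via the 1-cochain `(b₀, b₁)`
    (b₀ : g →ₗ[k] W) (b₁ : M →ₗ[k] V)
    (hb₀α : ∀ x, αW (b₀ x) = b₀ (α x)) (hb₁α : ∀ m, αV (b₁ m) = b₁ (αM m))
    (hcobθ : ∀ m, θ m - θ' m = φ (b₁ m) - b₀ (f m))
    (hcobω : ∀ x y, ω x y - ω' x y = laW x (b₀ y) + raW (b₀ x) y - b₀ (mul x y))
    (hcobμ : ∀ x m, μ x m - μ' x m = laV x (b₁ m) + tr (b₀ x) m - b₁ (la x m))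
    (hcobν : ∀ m x, ν m x - ν' m x = raV (b₁ m) x + tl m (b₀ x) - b₁ (ra m x)) :
    -- `F₀(x + w) := x + b₀(x) + w` and `F₁(m + v) := m + b₁(m) + v` ...
    ∀ (F₀ : g × W → g × W) (F₁ : M × V → M × V),
      (∀ a : g × W, F₀ a = (a.1, b₀ a.1 + a.2)) →
      (∀ u : M × V, F₁ u = (u.1, b₁ u.1 + u.2)) →
      -- ... commute with the hom maps,
      ((∀ a : g × W, F₀ (α a.1, αW a.2) = (α (F₀ a).1, αW (F₀ a).2)) ∧
       (∀ u : M × V, F₁ (αM u.1, αV u.2) = (αM (F₁ u).1, αV (F₁ u).2)) ∧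
      -- preserve the product of the extension of `(ω, μ, ν, θ)` to that of
      -- `(ω', μ', ν', θ')`,
       (∀ a b : g × W,
         F₀ ((mul a.1 b.1, ω a.1 b.1 + laW a.1 b.2 + raW a.2 b.1))
           = (mul (F₀ a).1 (F₀ b).1,
              ω' (F₀ a).1 (F₀ b).1 + laW (F₀ a).1 (F₀ b).2 + raW (F₀ a).2 (F₀ b).1)) ∧
      -- preserve the left action,
       (∀ (a : g × W) (u : M × V),
         F₁ ((la a.1 u.1, μ a.1 u.1 + laV a.1 u.2 + tr a.2 u.1))
           = (la (F₀ a).1 (F₁ u).1,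
              μ' (F₀ a).1 (F₁ u).1 + laV (F₀ a).1 (F₁ u).2 + tr (F₀ a).2 (F₁ u).1)) ∧
      -- preserve the right action,
       (∀ (u : M × V) (a : g × W),
         F₁ ((ra u.1 a.1, ν u.1 a.1 + raV u.2 a.1 + tl u.1 a.2))
           = (ra (F₁ u).1 (F₀ a).1,
              ν' (F₁ u).1 (F₀ a).1 + raV (F₁ u).2 (F₀ a).1 + tl (F₁ u).1 (F₀ a).2)) ∧
      -- intertwine the structure maps `f̂`, `f̂'`,
       (∀ u : M × V,
         ((f (F₁ u).1, θ' (F₁ u).1 + φ (F₁ u).2) : g × W)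
           = F₀ ((f u.1, θ u.1 + φ u.2))) ∧
      -- commute with the inclusions of `(V, W, φ)`
       (∀ w : W, F₀ ((0 : g), w) = ((0 : g), w)) ∧
       (∀ v : V, F₁ ((0 : M), v) = ((0 : M), v)) ∧
      -- and with the projections onto `(M, g, f)`
       (∀ a : g × W, (F₀ a).1 = a.1) ∧
       (∀ u : M × V, (F₁ u).1 = u.1)) := by
  intro F₀ F₁ h₀ h₁
  refine ⟨?_, ?_, ?_, ?_, ?_, ?_, ?_, ?_, ?_, ?_⟩
  · intro a
    simp [h₀, hb₀α]
  · intro u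
    simp [h₁, hb₁α]
  · intro a b
    have h := sub_eq_iff_eq_add.mp (hcobω a.1 b.1)
    simp only [h₀, h, map_add, LinearMap.add_apply, Prod.mk.injEq, true_and]
    abel
  · intro a u
    have h := sub_eq_iff_eq_add.mp (hcobμ a.1 u.1)
    simp only [h₀, h₁, h, map_add, LinearMap.add_apply, Prod.mk.injEq, true_and]
    abel
  · intro u a
    have h := sub_eq_iff_eq_add.mp (hcobν u.1 a.1)
    simp only [h₀, h₁, h, map_add, LinearMap.add_apply, Prod.mk.injEq, true_and]
    abel
  · intro u
    have h := sub_eq_iff_eq_add.mp (hcobθ u.1)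
    simp only [h₀, h₁, h, map_add, Prod.mk.injEq, true_and]
    abel
  · intro w
    simp [h₀]
  · intro v
    simp [h₁]
  · intro a
    simp [h₀]
  · intro u
    simp [h₁]
end

section
/- Let Ê (with projections p₀, p₁) and Ẽ (with projections q₀, q₁) be two abelian extensions of the left Hom-Leibniz algebra (M, g, f) in LM by (V, W, φ), equivalent via a morphism F = (F₀, F₁) of left Hom-Leibniz algebras in LM that restricts to the identity on W and on V and satisfies q₀∘F₀ = p₀, q₁∘F₁ = p₁. Then the two extensions induce the same bimodule structure on (V, W, φ): for any splitting (σ₀, σ₁) of Ê and any splitting (σ'₀, σ'₁) of Ẽ, and for all x ∈ g, m ∈ M, w ∈ W, v ∈ V, one has σ'₀(x)w = σ₀(x)w, wσ'₀(x) = wσ₀(x), σ'₀(x)·v = σ₀(x)·v, v·σ'₀(x) = v·σ₀(x), w·σ'₁(m) = w·σ₁(m), and σ'₁(m)·w = σ₁(m)·w, where products and actions on the left-hand sides are computed in Ẽ and on the right-hand sides in Ê. -/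
/-- Equivalent abelian extensions of a left Hom-Leibniz algebra
`(M, g, f)` in `LM` by `(V, W, φ)` induce the same bimodule structure on `(V, W, φ)`,
for any choices of splittings. -/
theorem equivalent_extensions_same_bimodule
    {k g M gh Mh gt Mt W V : Type*} [Field k] [CharZero k]
    [AddCommGroup g] [Module k g] [AddCommGroup M] [Module k M]
    [AddCommGroup gh] [Module k gh] [AddCommGroup Mh] [Module k Mh]
    [AddCommGroup gt] [Module k gt] [AddCommGroup Mt] [Module k Mt]
    [AddCommGroup W] [Module k W] [AddCommGroup V] [Module k V]
    -- the base left Hom-Leibniz algebra `(M, g, f)` in `LM`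
    (mul : g →ₗ[k] g →ₗ[k] g) (α : g →ₗ[k] g)
    (la : g →ₗ[k] M →ₗ[k] M) (ra : M →ₗ[k] g →ₗ[k] M) (αM : M →ₗ[k] M)
    (f : M →ₗ[k] g)
    (hlm : IsLMHomLeibniz (fun x y => mul x y) ⇑α
      (fun x m => la x m) (fun m x => ra m x) ⇑αM ⇑f)
    -- the extension `Ê = (M̂, ĝ, f̂)`
    (mulh : gh →ₗ[k] gh →ₗ[k] gh) (αh : gh →ₗ[k] gh)
    (lah : gh →ₗ[k] Mh →ₗ[k] Mh) (rah : Mh →ₗ[k] gh →ₗ[k] Mh) (αMh : Mh →ₗ[k] Mh)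
    (fh : Mh →ₗ[k] gh)
    (hlmh : IsLMHomLeibniz (fun a b => mulh a b) ⇑αh
      (fun a u => lah a u) (fun u a => rah u a) ⇑αMh ⇑fh)
    (p₀ : gh →ₗ[k] g) (p₁ : Mh →ₗ[k] M)
    (hp₀surj : Function.Surjective ⇑p₀) (hp₁surj : Function.Surjective ⇑p₁)
    (hpα : ∀ a, p₀ (αh a) = α (p₀ a)) (hpαM : ∀ u, p₁ (αMh u) = αM (p₁ u))
    (hpmul : ∀ a b, p₀ (mulh a b) = mul (p₀ a) (p₀ b))
    (hpla : ∀ a u, p₁ (lah a u) = la (p₀ a) (p₁ u))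
    (hpra : ∀ u a, p₁ (rah u a) = ra (p₁ u) (p₀ a))
    (hpf : ∀ u, p₀ (fh u) = f (p₁ u))
    (habmulh : ∀ a b, p₀ a = 0 → p₀ b = 0 → mulh a b = 0)
    (hablah : ∀ a u, p₀ a = 0 → p₁ u = 0 → lah a u = 0)
    (habrah : ∀ u a, p₁ u = 0 → p₀ a = 0 → rah u a = 0)
    -- the extension `Ẽ = (M̃, g̃, f̃)`
    (mult : gt →ₗ[k] gt →ₗ[k] gt) (αt : gt →ₗ[k] gt)
    (lat : gt →ₗ[k] Mt →ₗ[k] Mt) (rat : Mt →ₗ[k] gt →ₗ[k] Mt) (αMt : Mt →ₗ[k] Mt)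
    (ft : Mt →ₗ[k] gt)
    (hlmt : IsLMHomLeibniz (fun a b => mult a b) ⇑αt
      (fun a u => lat a u) (fun u a => rat u a) ⇑αMt ⇑ft)
    (q₀ : gt →ₗ[k] g) (q₁ : Mt →ₗ[k] M)
    (hq₀surj : Function.Surjective ⇑q₀) (hq₁surj : Function.Surjective ⇑q₁)
    (hqα : ∀ a, q₀ (αt a) = α (q₀ a)) (hqαM : ∀ u, q₁ (αMt u) = αM (q₁ u))
    (hqmul : ∀ a b, q₀ (mult a b) = mul (q₀ a) (q₀ b))
    (hqla : ∀ a u, q₁ (lat a u) = la (q₀ a) (q₁ u))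
    (hqra : ∀ u a, q₁ (rat u a) = ra (q₁ u) (q₀ a))
    (hqf : ∀ u, q₀ (ft u) = f (q₁ u))
    (habmult : ∀ a b, q₀ a = 0 → q₀ b = 0 → mult a b = 0)
    (hablat : ∀ a u, q₀ a = 0 → q₁ u = 0 → lat a u = 0)
    (habrat : ∀ u a, q₁ u = 0 → q₀ a = 0 → rat u a = 0)
    -- both extensions are by the same `(V, W, φ)`
    (ι₀ : W →ₗ[k] gh) (ι₁ : V →ₗ[k] Mh) (ι₀' : W →ₗ[k] gt) (ι₁' : V →ₗ[k] Mt)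
    (hι₀inj : Function.Injective ⇑ι₀) (hι₁inj : Function.Injective ⇑ι₁)
    (hι₀'inj : Function.Injective ⇑ι₀') (hι₁'inj : Function.Injective ⇑ι₁')
    (hexact₀ : ∀ a : gh, p₀ a = 0 ↔ a ∈ Set.range ⇑ι₀)
    (hexact₁ : ∀ u : Mh, p₁ u = 0 ↔ u ∈ Set.range ⇑ι₁)
    (hexact₀' : ∀ a : gt, q₀ a = 0 ↔ a ∈ Set.range ⇑ι₀')
    (hexact₁' : ∀ u : Mt, q₁ u = 0 ↔ u ∈ Set.range ⇑ι₁')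
    (φ : V →ₗ[k] W)
    (hφh : ∀ v, fh (ι₁ v) = ι₀ (φ v)) (hφt : ∀ v, ft (ι₁' v) = ι₀' (φ v))
    -- an equivalence `F = (F₀, F₁)` of abelian extensions
    (F₀ : gh →ₗ[k] gt) (F₁ : Mh →ₗ[k] Mt)
    (hFα : ∀ a, F₀ (αh a) = αt (F₀ a)) (hFαM : ∀ u, F₁ (αMh u) = αMt (F₁ u))
    (hFmul : ∀ a b, F₀ (mulh a b) = mult (F₀ a) (F₀ b))
    (hFla : ∀ a u, F₁ (lah a u) = lat (F₀ a) (F₁ u))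
    (hFra : ∀ u a, F₁ (rah u a) = rat (F₁ u) (F₀ a))
    (hFf : ∀ u, ft (F₁ u) = F₀ (fh u))
    (hFW : ∀ w, F₀ (ι₀ w) = ι₀' w) (hFV : ∀ v, F₁ (ι₁ v) = ι₁' v)
    (hFp : ∀ a, q₀ (F₀ a) = p₀ a) (hFq : ∀ u, q₁ (F₁ u) = p₁ u) :
    -- for any splittings of the two extensions, the induced bimodule structures
    -- on `(V, W, φ)` agree (identifying `W`, `V` inside `Ê` and `Ẽ` via `F`)
    ∀ (σ₀ : g →ₗ[k] gh) (σ₁ : M →ₗ[k] Mh) (σ₀' : g →ₗ[k] gt) (σ₁' : M →ₗ[k] Mt),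
      (∀ x, p₀ (σ₀ x) = x) → (∀ m, p₁ (σ₁ m) = m) →
      (∀ m, fh (σ₁ m) = σ₀ (f m)) →
      (∀ x, αh (σ₀ x) = σ₀ (α x)) → (∀ m, αMh (σ₁ m) = σ₁ (αM m)) →
      (∀ x, q₀ (σ₀' x) = x) → (∀ m, q₁ (σ₁' m) = m) →
      (∀ m, ft (σ₁' m) = σ₀' (f m)) →
      (∀ x, αt (σ₀' x) = σ₀' (α x)) → (∀ m, αMt (σ₁' m) = σ₁' (αM m)) →
      ∀ (x : g) (m : M) (w : W) (v : V),
        -- `x · w` agrees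
        F₀ (mulh (σ₀ x) (ι₀ w)) = mult (σ₀' x) (ι₀' w) ∧
        -- `w · x` agrees
        F₀ (mulh (ι₀ w) (σ₀ x)) = mult (ι₀' w) (σ₀' x) ∧
        -- `x · v` agrees
        F₁ (lah (σ₀ x) (ι₁ v)) = lat (σ₀' x) (ι₁' v) ∧
        -- `v · x` agrees
        F₁ (rah (ι₁ v) (σ₀ x)) = rat (ι₁' v) (σ₀' x) ∧
        -- `w ▷ m` agrees
        F₁ (lah (ι₀ w) (σ₁ m)) = lat (ι₀' w) (σ₁' m) ∧
        -- `m ◁ w` agrees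
        F₁ (rah (σ₁ m) (ι₀ w)) = rat (σ₁' m) (ι₀' w) := by
  intro σ₀ σ₁ σ₀' σ₁' hσ₀ hσ₁ _ _ _ hσ₀' hσ₁' _ _ _ x m w v
  have hw : q₀ (ι₀' w) = 0 := (hexact₀' _).2 ⟨w, rfl⟩
  have hv : q₁ (ι₁' v) = 0 := (hexact₁' _).2 ⟨v, rfl⟩
  have hx : q₀ (F₀ (σ₀ x) - σ₀' x) = 0 := by
    rw [map_sub, hFp, hσ₀, hσ₀', sub_self]
  have hm : q₁ (F₁ (σ₁ m) - σ₁' m) = 0 := by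
    rw [map_sub, hFq, hσ₁, hσ₁', sub_self]
  rw [hFmul, hFmul, hFla, hFra, hFla, hFra, hFW, hFV]
  refine ⟨?_, ?_, ?_, ?_, ?_, ?_⟩
  · have h := habmult _ _ hx hw
    rwa [map_sub, LinearMap.sub_apply, sub_eq_zero] at h
  · have h := habmult _ _ hw hx
    rwa [map_sub, sub_eq_zero] at h
  · have h := hablat _ _ hx hv
    rwa [map_sub, LinearMap.sub_apply, sub_eq_zero] at h
  · have h := habrat _ _ hv hx
    rwa [map_sub, sub_eq_zero] at h
  · have h := hablat _ _ hw hm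
    rwa [map_sub, sub_eq_zero] at h
  · have h := habrat _ _ hm hw
    rwa [map_sub, LinearMap.sub_apply, sub_eq_zero] at h
end
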